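/- Let n ≥ 2k > 1. If there exists a proper coloring c of the (n,k)-Kneser graph using the n − 2k + 1 colors {2k, …, n}, then there exists an antipodal map λ : B^n_k → {±2k, …, ±n} with no k-complementary pair of elements of B^n_k. (Taking any total order ≤ on the k-subsets of [n] together with ∅ that refines ≼, define λ(A,B) = c(A) if A > B and λ(A,B) = −c(B) if B > A.) -/

import Mathlib

/-- `leastK k A` is the set `A_{≤k}` of the `k` least elements of `A`
(all of `A` if `|A| ≤ k`; in particular `∅_{≤k} = ∅`). -/
def leastK {n : ℕ} (k : ℕ) (A : Finset (Fin n)) : Finset (Fin n) :=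
  ((A.sort (· ≤ ·)).take k).toFinset

/-- The relation `A₁ ≼ A₂` defined by `(A₁ ∪ A₂)_{≤k} = A₂`. -/
def precRel {n : ℕ} (k : ℕ) (A₁ A₂ : Finset (Fin n)) : Prop :=
  leastK k (A₁ ∪ A₂) = A₂

/-- Membership in the truncated octahedral ball `Bⁿ_k`: `A` and `B` are each a
`k`-element subset of `[n]` or empty, are disjoint, and are not both empty. -/
def memBnk {n : ℕ} (k : ℕ) (A B : Finset (Fin n)) : Prop :=
  (A.card = k ∨ A = ∅) ∧ (B.card = k ∨ B = ∅) ∧ Disjoint A B ∧ ¬(A = ∅ ∧ B = ∅)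

/-- The pair order `(A₁,B₁) ≼ (A₂,B₂)`: `A₁ ≼ A₂`, `B₁ ≼ B₂`, and `Aᵢ ∩ Bⱼ = ∅`
for all `i,j ∈ {1,2}`. -/
def precPair {n : ℕ} (k : ℕ) (A₁ B₁ A₂ B₂ : Finset (Fin n)) : Prop :=
  precRel k A₁ A₂ ∧ precRel k B₁ B₂ ∧
    Disjoint A₁ B₁ ∧ Disjoint A₁ B₂ ∧ Disjoint A₂ B₁ ∧ Disjoint A₂ B₂

/-- Let `n ≥ 2k > 1`. If there is a proper coloring of the `(n,k)`-Kneser graph using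
the `n - 2k + 1` colors `{2k, …, n}`, then there is an antipodal map
`λ : Bⁿ_k → {±2k, …, ±n}` with no `k`-complementary pair of elements of `Bⁿ_k`. -/
theorem coloring_to_tucker_counterexample (n k : ℕ) (hk : 1 ≤ k) (hn : 2 * k ≤ n)
    (c : Finset (Fin n) → ℕ)
    (hrange : ∀ S : Finset (Fin n), S.card = k → c S ∈ Finset.Icc (2 * k) n)
    (hproper : ∀ S T : Finset (Fin n), S.card = k → T.card = k →
      Disjoint S T → c S ≠ c T) :
    ∃ lam : Finset (Fin n) → Finset (Fin n) → ℤ,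
      (∀ A B : Finset (Fin n), memBnk k A B →
        2 * k ≤ (lam A B).natAbs ∧ (lam A B).natAbs ≤ n) ∧
      (∀ A B : Finset (Fin n), memBnk k A B → lam A B = - lam B A) ∧
      ¬ ∃ A₁ B₁ A₂ B₂ : Finset (Fin n),
        memBnk k A₁ B₁ ∧ memBnk k A₂ B₂ ∧ precPair k A₁ B₁ A₂ B₂ ∧
        lam A₁ B₁ = - lam A₂ B₂ := by
  classical
  have key : ∀ A B : Finset (Fin n), toColex B < toColex A → A ≠ ∅ := by
    rintro A B h rfl
    exact absurd h (not_lt_of_ge (Finset.Colex.toColex_mono (Finset.empty_subset B)))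
  have tri : ∀ A B : Finset (Fin n), memBnk k A B →
      ¬ toColex B < toColex A → toColex A < toColex B := by
    rintro A B ⟨-, -, hd, hne⟩ h
    refine lt_of_le_of_ne (not_lt.mp h) ?_
    intro he
    have hAB : A = B := toColex_inj.mp he
    subst hAB
    have h0 : A = ∅ := by simpa using hd
    exact hne ⟨h0, h0⟩
  have fact : ∀ A B : Finset (Fin n), memBnk k A B →
      (toColex B < toColex A ∧ ¬ toColex A < toColex B ∧ A.card = k) ∨
      (¬ toColex B < toColex A ∧ toColex A < toColex B ∧ B.card = k) := by
    intro A B h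
    by_cases hlt : toColex B < toColex A
    · exact Or.inl ⟨hlt, lt_asymm hlt, h.1.resolve_right (key A B hlt)⟩
    · have hl := tri A B h hlt
      exact Or.inr ⟨hlt, hl, h.2.1.resolve_right (key B A hl)⟩
  refine ⟨fun A B => if toColex B < toColex A then (c A : ℤ) else -(c B : ℤ), ?_, ?_, ?_⟩
  · intro A B h
    rcases fact A B h with ⟨h1, -, h3⟩ | ⟨h1, -, h3⟩
    · have := Finset.mem_Icc.mp (hrange A h3)
      simpa [h1] using this
    · have := Finset.mem_Icc.mp (hrange B h3)
      simpa [h1] using this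
  · intro A B h
    rcases fact A B h with ⟨h1, h2, -⟩ | ⟨h1, h2, -⟩
    · simp only [if_pos h1, if_neg h2, neg_neg]
    · simp only [if_pos h2, if_neg h1]
  · rintro ⟨A₁, B₁, A₂, B₂, m1, m2, ⟨-, -, -, d12, d21, -⟩, he⟩
    rcases fact A₁ B₁ m1 with ⟨h1, -, h3⟩ | ⟨h1, -, h3⟩ <;>
    rcases fact A₂ B₂ m2 with ⟨g1, -, g3⟩ | ⟨g1, -, g3⟩
    · simp only [if_pos h1, if_pos g1] at he
      have := Finset.mem_Icc.mp (hrange A₁ h3)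
      omega
    · simp only [if_pos h1, if_neg g1] at he
      exact hproper _ _ h3 g3 d12 (by omega)
    · simp only [if_neg h1, if_pos g1] at he
      exact hproper _ _ g3 h3 d21 (by omega)
    · simp only [if_neg h1, if_neg g1] at he
      have := Finset.mem_Icc.mp (hrange B₁ h3)
      omega
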